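/- There exists a separable metrizable space X (a subspace of Baire space ω^ω) that has the perfect set property for analytic subsets but not for coanalytic subsets: X = Z ∪ (ω^ω ∖ WO), where WO is the set of codes of well-orderings of ω and Z ⊆ WO picks one code z_α of each infinite countable order type α. -/

import Mathlib

/-- `A` contains a homeomorphic copy of the Cantor set `2^ω`. -/
def ContainsCantorCopy {T : Type} [TopologicalSpace T] (A : Set T) : Prop :=
  ∃ f : (ℕ → Bool) → T, Continuous f ∧ Function.Injective f ∧ Set.range f ⊆ A

/-- The binary relation on `ω` coded by `x ∈ ω^ω`. -/
def codedRel (x : ℕ → ℕ) : ℕ → ℕ → Prop := fun m n => x (Nat.pair m n) = 0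

/-- `WO`: the set of codes of well-orderings of `ω`. -/
def WOset : Set (ℕ → ℕ) := {x | IsWellOrder ℕ (codedRel x)}

/-- The order type coded by `x ∈ WO`. -/
noncomputable def codedType (x : ℕ → ℕ) (h : IsWellOrder ℕ (codedRel x)) : Ordinal.{0} :=
  @Ordinal.type ℕ (codedRel x) h

/-- `X` has the perfect set property for (relatively) analytic subsets. -/
def PSPanalytic {T : Type} [TopologicalSpace T] (X : Set T) : Prop :=
  ∀ A : Set T, MeasureTheory.AnalyticSet A → ¬ (A ∩ X).Countable →
    ContainsCantorCopy (A ∩ X)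

/-- `X` has the perfect set property for (relatively) coanalytic subsets. -/
def PSPcoanalytic {T : Type} [TopologicalSpace T] (X : Set T) : Prop :=
  ∀ A : Set T, MeasureTheory.AnalyticSet Aᶜ → ¬ (A ∩ X).Countable →
    ContainsCantorCopy (A ∩ X)

open Set Filter Topology MeasureTheory Ordinal

/-- In a second countable space, all but countably many points of a set are condensation points
of that set. -/
theorem countable_setOf_not_condensation {X : Type*} [TopologicalSpace X]
    [SecondCountableTopology X] (A : Set X) :
    {x ∈ A | ∃ U ∈ 𝓝 x, (U ∩ A).Countable}.Countable := by
  set N := {x ∈ A | ∃ U ∈ 𝓝 x, (U ∩ A).Countable} with hN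
  have key : ∀ x, ∃ U, x ∈ N → U ∈ 𝓝 x ∧ (U ∩ A).Countable := fun x => by
    by_cases hx : x ∈ N
    · obtain ⟨U, hU⟩ := hx.2
      exact ⟨U, fun _ => hU⟩
    · exact ⟨∅, fun h => absurd h hx⟩
  choose U hU using key
  obtain ⟨t, htN, htc, ht⟩ := TopologicalSpace.countable_cover_nhdsWithin
    (f := U) (s := N) fun x hx => mem_nhdsWithin_of_mem_nhds (hU x hx).1
  refine (htc.biUnion fun x hx => (hU x (htN hx)).2).mono fun x hx => ?_
  obtain ⟨y, hy, hxy⟩ := mem_iUnion₂.1 (ht hx)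
  exact mem_iUnion₂.2 ⟨y, hy, hxy, hx.1⟩

/-- An uncountable set in a second countable space has two distinct condensation points. -/
theorem exists_ne_condensation {X : Type*} [TopologicalSpace X]
    [SecondCountableTopology X] {A : Set X} (hA : ¬ A.Countable) :
    ∃ x ∈ A, ∃ y ∈ A, x ≠ y ∧ (∀ U ∈ 𝓝 x, ¬ (U ∩ A).Countable) ∧
      ∀ U ∈ 𝓝 y, ¬ (U ∩ A).Countable := by
  have hB : ¬ (A \ {x ∈ A | ∃ U ∈ 𝓝 x, (U ∩ A).Countable}).Countable := fun h =>
    hA ((h.union (countable_setOf_not_condensation A)).mono fun x hx => by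
      by_cases h : x ∈ {x ∈ A | ∃ U ∈ 𝓝 x, (U ∩ A).Countable}
      · exact Or.inr h
      · exact Or.inl ⟨hx, h⟩)
  have hnt : (A \ {x ∈ A | ∃ U ∈ 𝓝 x, (U ∩ A).Countable}).Nontrivial := by
    by_contra h
    exact hB (not_nontrivial_iff.1 h).countable
  obtain ⟨x, hx, y, hy, hxy⟩ := hnt
  exact ⟨x, hx.1, y, hy.1, hxy, fun U hU h => hx.2 ⟨hx.1, U, hU, h⟩,
    fun U hU h => hy.2 ⟨hy.1, U, hU, h⟩⟩

/-- A closed set meeting `S` uncountably splits into two small closed subsets with the same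
property and with disjoint images under a continuous map that is injective on `S`. -/
theorem exists_small_splitting {X T : Type*} [MetricSpace X] [SecondCountableTopology X]
    [TopologicalSpace T] [T2Space T] {f : X → T} (hf : Continuous f) {S : Set X}
    (hS : InjOn f S) {E : Set X} (hE : IsClosed E) (hES : ¬ (E ∩ S).Countable) {ε : ENNReal}
    (hε : 0 < ε) :
    ∃ C₀ C₁ : Set X,
      ((IsClosed C₀ ∧ ¬ (C₀ ∩ S).Countable) ∧ C₀ ⊆ E ∧ Metric.ediam C₀ ≤ ε) ∧
      ((IsClosed C₁ ∧ ¬ (C₁ ∩ S).Countable) ∧ C₁ ⊆ E ∧ Metric.ediam C₁ ≤ ε) ∧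
      Disjoint (f '' C₀) (f '' C₁) := by
  have aux : ∀ x, (∀ U ∈ 𝓝 x, ¬ (U ∩ (E ∩ S)).Countable) → ∀ U ∈ 𝓝 (f x),
      ∃ C : Set X, ((IsClosed C ∧ ¬ (C ∩ S).Countable) ∧ C ⊆ E ∧ Metric.ediam C ≤ ε) ∧
        f '' C ⊆ U := by
    intro x hx U hU
    have h1 : f ⁻¹' U ∩ Metric.eball x (ε / 2) ∈ 𝓝 x :=
      inter_mem (hf.continuousAt.preimage_mem_nhds hU)
        (Metric.eball_mem_nhds _ (ENNReal.half_pos hε.ne'))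
    obtain ⟨K, hK, hKc, hKs⟩ := exists_mem_nhds_isClosed_subset h1
    refine ⟨K ∩ E, ⟨⟨hKc.inter hE, ?_⟩, inter_subset_right, ?_⟩, ?_⟩
    · rw [inter_assoc]
      exact hx K hK
    · calc Metric.ediam (K ∩ E) ≤ Metric.ediam (Metric.eball x (ε / 2)) :=
            Metric.ediam_mono fun z hz => (hKs hz.1).2
        _ ≤ 2 * (ε / 2) := Metric.ediam_eball_le
        _ = ε := ENNReal.mul_div_cancel (by simp) (by simp)
    · rintro _ ⟨z, hz, rfl⟩
      exact (hKs hz.1).1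
  obtain ⟨x, hx, y, hy, hxy, hxc, hyc⟩ := exists_ne_condensation hES
  obtain ⟨U, V, hU, hV, hxU, hyV, hUV⟩ := t2_separation fun h => hxy (hS hx.2 hy.2 h)
  obtain ⟨C₀, h₀, h₀U⟩ := aux x hxc U (hU.mem_nhds hxU)
  obtain ⟨C₁, h₁, h₁V⟩ := aux y hyc V (hV.mem_nhds hyV)
  exact ⟨C₀, C₁, h₀, h₁, hUV.mono h₀U h₁V⟩

open CantorScheme in
/-- An uncountable continuous image of a Polish space contains a copy of the Cantor space. -/
theorem containsCantorCopy_range {X T : Type} [TopologicalSpace X] [PolishSpace X]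
    [TopologicalSpace T] [T2Space T] {f : X → T} (hf : Continuous f)
    (hr : ¬ (range f).Countable) : ContainsCantorCopy (range f) := by
  let _ := TopologicalSpace.upgradeIsCompletelyMetrizable X
  obtain ⟨S, -, hS⟩ := (surjOn_image f univ).exists_bijOn_subset
  have hSu : ¬ S.Countable := fun h => hr (by
    rw [← image_univ, ← hS.image_eq]
    exact h.image f)
  obtain ⟨u, -, upos', hu⟩ := exists_seq_strictAnti_tendsto' (zero_lt_one' ENNReal)
  have upos := fun n => (upos' n).1
  let P := Subtype fun E : Set X => IsClosed E ∧ ¬ (E ∩ S).Countable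
  choose C0 C1 h0 h1 hdisj using
    fun {E : Set X} (hE : IsClosed E ∧ ¬ (E ∩ S).Countable) {ε : ENNReal} (hε : 0 < ε) =>
    exists_small_splitting hf hS.injOn hE.1 hE.2 hε
  let DP : List Bool → P := fun l => by
    induction l with
    | nil => exact ⟨univ, isClosed_univ, by rwa [univ_inter]⟩
    | cons a l ih =>
      cases a
      · exact ⟨C0 ih.property (upos (l.length + 1)), (h0 _ _).1⟩
      · exact ⟨C1 ih.property (upos (l.length + 1)), (h1 _ _).1⟩
  let D : List Bool → Set X := fun l => (DP l).val
  have hanti : ClosureAntitone D := by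
    refine Antitone.closureAntitone ?_ fun l => (DP l).property.1
    intro l a
    cases a
    · exact (h0 _ _).2.1
    · exact (h1 _ _).2.1
  have hdiam : VanishingDiam D := by
    intro x
    apply tendsto_of_tendsto_of_tendsto_of_le_of_le' tendsto_const_nhds hu
    · simp
    rw [eventually_atTop]
    refine ⟨1, fun m (hm : 1 ≤ m) => ?_⟩
    obtain ⟨n, rfl⟩ := Nat.exists_eq_succ_of_ne_zero (Nat.one_le_iff_ne_zero.1 hm)
    dsimp
    cases x n
    · convert! (h0 _ _).2.2
      rw [PiNat.res_length]
    · convert! (h1 _ _).2.2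
      rw [PiNat.res_length]
  have hdisj' : ∀ l a b, a ≠ b → Disjoint (f '' D (a :: l)) (f '' D (b :: l)) := by
    rintro l (a | a) (b | b) hab <;> try contradiction
    · exact hdisj _ _
    · exact (hdisj _ _).symm
  have hne : ∀ l, (D l).Nonempty := fun l => by
    by_contra h
    refine (DP l).property.2 ?_
    rw [show (DP l).val = ∅ from not_nonempty_iff_eq_empty.1 h, empty_inter]
    exact countable_empty
  have hdom : ∀ {x : ℕ → Bool}, x ∈ (inducedMap D).1 := fun {x} => by
    rw [hanti.map_of_vanishingDiam hdiam hne]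
    apply mem_univ
  refine ⟨fun x => f ((inducedMap D).2 ⟨x, hdom⟩), ?_, ?_, ?_⟩
  · exact hf.comp (hdiam.map_continuous.comp (by fun_prop))
  · intro x y hxy
    by_contra hne
    have h := PiNat.apply_firstDiff_ne hne
    set n := PiNat.firstDiff x y
    have hres : PiNat.res x n = PiNat.res y n :=
      PiNat.res_eq_res.2 fun i hi => PiNat.apply_eq_of_lt_firstDiff hi
    have hx := map_mem (A := D) ⟨x, hdom⟩ (n + 1)
    have hy := map_mem (A := D) ⟨y, hdom⟩ (n + 1)
    rw [PiNat.res_succ] at hx hy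
    rw [hres] at hx
    refine Set.disjoint_left.1 (hdisj' _ _ _ h) (mem_image_of_mem f hx) ?_
    rw [show f _ = f _ from hxy]
    exact mem_image_of_mem f hy
  · rintro _ ⟨x, rfl⟩
    exact mem_range_self _

/-- Suslin's perfect set theorem. -/
theorem containsCantorCopy_of_analyticSet {T : Type} [TopologicalSpace T] [T2Space T]
    {A : Set T} (hA : AnalyticSet A) (hc : ¬ A.Countable) : ContainsCantorCopy A := by
  rw [AnalyticSet] at hA
  obtain rfl | ⟨f, hf, rfl⟩ := hA
  · exact absurd countable_empty hc
  · exact containsCantorCopy_range hf hc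

/-- The rank function of a well-founded relation on a countable type is bounded below `ω₁`. -/
theorem rank_lt_omega_one {α : Type*} [Countable α] (r : α → α → Prop) [IsWellFounded α r]
    (a : α) : IsWellFounded.rank r a < ω₁ := by
  induction a using IsWellFounded.induction r with
  | _ a ih =>
    rw [IsWellFounded.rank_eq]
    exact Ordinal.iSup_lt_omega_one fun b => (Cardinal.isSuccLimit_omega 1).succ_lt (ih b b.2)

theorem isClopen_setOf_codedRel (m n : ℕ) : IsClopen {x | codedRel x m n} :=
  (isClopen_discrete {0}).preimage (continuous_apply (Nat.pair m n))

/-- The boundedness lemma: the order types of an analytic set of codes of well-orderings are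
bounded below `ω₁`. -/
theorem exists_codedType_le_of_analyticSet {A : Set (ℕ → ℕ)} (hA : AnalyticSet A)
    (hAW : A ⊆ WOset) : ∃ o < ω₁, ∀ x ∈ A, ∀ h, codedType x h ≤ o := by
  rw [AnalyticSet] at hA
  obtain rfl | ⟨g, hg, rfl⟩ := hA
  · exact ⟨0, omega_pos 1, by simp⟩
  set e := TopologicalSpace.denseSeq (ℕ → ℕ)
  let R : ℕ × ℕ × ℕ → ℕ × ℕ × ℕ → Prop := fun p q =>
    q.1 < p.1 ∧ (∀ i < q.1, e p.2.1 i = e q.2.1 i) ∧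
      ∀ y, (∀ i < p.1, e p.2.1 i = y i) → codedRel (g y) p.2.2 q.2.2
  have hR : IsWellFounded _ R := ⟨by
    rw [wellFounded_iff_isEmpty_descending_chain]
    refine ⟨fun ⟨c, hc⟩ => ?_⟩
    have hmono : StrictMono fun n => (c n).1 := strictMono_nat_of_lt_succ fun n => (hc n).1
    have hagree : ∀ j n, ∀ i < (c n).1, e (c (n + j)).2.1 i = e (c n).2.1 i := by
      intro j n i hi
      induction j with
      | zero => rfl
      | succ j ih =>
        rw [← ih]
        exact (hc (n + j)).2.1 i (hi.trans_le (hmono.monotone (Nat.le_add_right n j)))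
    let y : ℕ → ℕ := fun i => e (c (i + 1)).2.1 i
    have hy : ∀ n, ∀ i < (c n).1, e (c n).2.1 i = y i := by
      intro n i hi
      rw [← hagree (i + 1) n i hi, add_comm, hagree n (i + 1) i]
      exact (Nat.lt_succ_self i).trans_le (hmono.le_apply)
    have hwf : WellFounded (codedRel (g y)) := (hAW (mem_range_self y) : IsWellOrder _ _).wf
    rw [wellFounded_iff_isEmpty_descending_chain] at hwf
    exact hwf.false ⟨fun n => (c n).2.2, fun n => (hc n).2.2 y (hy (n + 1))⟩⟩
  refine ⟨⨆ p, IsWellFounded.rank R p + 1, Ordinal.iSup_lt_omega_one fun p =>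
    (Cardinal.isSuccLimit_omega 1).succ_lt (rank_lt_omega_one R p), ?_⟩
  rintro _ ⟨y, rfl⟩ h
  have key : ∀ n k d, (∀ i < k, e d i = y i) →
      IsWellFounded.rank (codedRel (g y)) n ≤ IsWellFounded.rank R (k, d, n) := by
    intro n
    induction n using IsWellFounded.induction (codedRel (g y)) with
    | _ n ih =>
      intro k d hd
      rw [IsWellFounded.rank_eq]
      refine Ordinal.iSup_le fun ⟨m, hm⟩ => ?_
      obtain ⟨_, ⟨z, l, rfl⟩, hyz, hz⟩ :=
        (PiNat.isTopologicalBasis_cylinders fun _ => ℕ).exists_subset_of_mem_open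
          (show y ∈ g ⁻¹' {x | codedRel x m n} from hm)
          ((isClopen_setOf_codedRel m n).isOpen.preimage hg)
      obtain ⟨d', hd'⟩ := (TopologicalSpace.denseRange_denseSeq (ℕ → ℕ)).exists_mem_open
        (PiNat.isOpen_cylinder _ y (max l (k + 1))) ⟨y, PiNat.self_mem_cylinder _ _⟩
      rw [PiNat.mem_cylinder_iff] at hd'
      refine Order.succ_le_of_lt ((ih m hm (max l (k + 1)) d' hd').trans_lt
        (IsWellFounded.rank_lt_of_rel ⟨?_, fun i hi => ?_, fun w hw => ?_⟩))
      · exact lt_max_of_lt_right k.lt_succ_self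
      · exact (hd' i (lt_max_of_lt_right (hi.trans k.lt_succ_self))).trans (hd i hi).symm
      · refine hz fun i hi => ?_
        have hi' : i < max l (k + 1) := lt_max_of_lt_left hi
        rw [← hw i hi', ← hyz i hi]
        exact hd' i hi'
  by_contra! hlt
  obtain ⟨n, hn⟩ := Ordinal.typein_surj (codedRel (g y)) hlt
  rw [← IsWellFounded.rank_eq_typein] at hn
  refine (key n 0 0 (by simp)).not_gt ?_
  rw [hn]
  exact (Order.lt_succ _).trans_le (Ordinal.le_iSup (fun p => IsWellFounded.rank R p + 1) _)

theorem analyticSet_compl_WOset : AnalyticSet WOsetᶜ := by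
  have hW : WOsetᶜ = {x | ¬ WellFounded (codedRel x)} ∪
      {x | ∃ m n, ¬ codedRel x m n ∧ ¬ codedRel x n m ∧ m ≠ n} := by
    ext x
    simp only [mem_compl_iff, mem_union, mem_ofPred_eq]
    rw [← not_iff_not, not_not]
    push Not
    refine ⟨fun h => ⟨?_, ?_⟩, fun h => ?_⟩
    · exact (show IsWellOrder _ _ from h).wf
    · exact fun m n => (show IsWellOrder _ _ from h).trichotomous m n
    · exact { wf := h.1, trichotomous := h.2 }
  have h1 : AnalyticSet {x | ¬ WellFounded (codedRel x)} := by
    have hcl : IsClosed {p : (ℕ → ℕ) × (ℕ → ℕ) | ∀ n, codedRel p.1 (p.2 (n + 1)) (p.2 n)} := by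
      have : {p : (ℕ → ℕ) × (ℕ → ℕ) | ∀ n, codedRel p.1 (p.2 (n + 1)) (p.2 n)} =
          ⋂ n, ⋂ a, ⋂ b, {p | p.2 (n + 1) = a → p.2 n = b → codedRel p.1 a b} := by
        ext p
        simp
      rw [this]
      refine isClosed_iInter fun n => isClosed_iInter fun a => isClosed_iInter fun b => ?_
      have ha : IsOpen {p : (ℕ → ℕ) × (ℕ → ℕ) | p.2 (n + 1) = a} :=
        (isOpen_discrete {a}).preimage
          (f := fun p : (ℕ → ℕ) × (ℕ → ℕ) => p.2 (n + 1)) (by fun_prop)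
      have hb : IsOpen {p : (ℕ → ℕ) × (ℕ → ℕ) | p.2 n = b} :=
        (isOpen_discrete {b}).preimage
          (f := fun p : (ℕ → ℕ) × (ℕ → ℕ) => p.2 n) (by fun_prop)
      exact isClosed_imp ha
        (isClosed_imp hb ((isClopen_setOf_codedRel a b).isClosed.preimage continuous_fst))
    convert hcl.analyticSet.image_of_continuous continuous_fst
    ext x
    simp [wellFounded_iff_isEmpty_descending_chain]
  have h2 : IsOpen {x | ∃ m n, ¬ codedRel x m n ∧ ¬ codedRel x n m ∧ m ≠ n} := by
    simp only [ofPred_exists]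
    refine isOpen_iUnion fun m => isOpen_iUnion fun n => ?_
    exact (isClopen_setOf_codedRel m n).compl.isOpen.inter
      ((isClopen_setOf_codedRel n m).compl.isOpen.inter isOpen_const)
  rw [hW, union_eq_iUnion]
  refine AnalyticSet.iUnion fun b => ?_
  cases b
  · exact h2.measurableSet.analyticSet
  · exact h1

/-- Every infinite countable ordinal is the type of a coded well-ordering of `ω`. -/
theorem exists_codedType_eq {α : Ordinal.{0}} (h0 : ω ≤ α) (h1 : α < ω₁) :
    ∃ x, ∃ h : IsWellOrder ℕ (codedRel x), codedType x h = α := by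
  have hcard : Cardinal.mk α.ToType = Cardinal.mk ℕ := by
    rw [Cardinal.mk_toType, Cardinal.mk_nat]
    refine le_antisymm ?_ ?_
    · rw [← Cardinal.ord_aleph, Cardinal.lt_ord, ← Cardinal.succ_aleph0] at h1
      exact Order.lt_succ_iff.1 h1
    · rw [← Ordinal.card_omega0]
      exact Ordinal.card_le_card h0
  obtain ⟨f⟩ := Cardinal.eq.1 hcard
  classical
  let x : ℕ → ℕ := fun k => if f.symm k.unpair.1 < f.symm k.unpair.2 then 0 else 1
  let E : codedRel x ≃r ((· < ·) : α.ToType → α.ToType → Prop) :=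
    ⟨f.symm, by simp [codedRel, x]⟩
  have hW : IsWellOrder ℕ (codedRel x) := E.toRelEmbedding.isWellOrder
  refine ⟨x, hW, ?_⟩
  rw [← α.type_toType]
  exact Ordinal.type_eq.2 ⟨E⟩

theorem countable_Iic_of_lt_omega_one {o : Ordinal.{0}} (ho : o < ω₁) : (Iic o).Countable := by
  rw [← Order.Iio_succ, ← Cardinal.le_aleph0_iff_set_countable, Cardinal.mk_Iio_ordinal,
    Cardinal.lift_le_aleph0]
  have h1 := (Cardinal.isSuccLimit_omega 1).succ_lt ho
  rw [← Cardinal.ord_aleph, Cardinal.lt_ord, ← Cardinal.succ_aleph0] at h1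
  exact Order.lt_succ_iff.1 h1

theorem exists_psp_analytic_not_psp_coanalytic :
    ∃ Z : Set (ℕ → ℕ), Z ⊆ WOset ∧
      -- each element of `Z` codes a well-ordering of some infinite countable type
      (∀ z ∈ Z, ∃ h : IsWellOrder ℕ (codedRel z),
        Ordinal.omega0 ≤ codedType z h ∧ codedType z h < (Cardinal.aleph 1).ord) ∧
      -- `Z` contains exactly one code of each infinite countable order type
      (∀ α : Ordinal.{0}, Ordinal.omega0 ≤ α → α < (Cardinal.aleph 1).ord →
        ∃ z ∈ Z, ∃ h : IsWellOrder ℕ (codedRel z), codedType z h = α) ∧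
      (∀ z ∈ Z, ∀ w ∈ Z, ∀ (hz : IsWellOrder ℕ (codedRel z))
        (hw : IsWellOrder ℕ (codedRel w)), codedType z hz = codedType w hw → z = w) ∧
      PSPanalytic (Z ∪ WOsetᶜ) ∧ ¬ PSPcoanalytic (Z ∪ WOsetᶜ) := by
  rw [Cardinal.ord_aleph]
  choose c hcW hc using fun α : {α : Ordinal.{0} // ω ≤ α ∧ α < ω₁} =>
    exists_codedType_eq α.2.1 α.2.2
  have hZW : range c ⊆ WOset := by
    rintro _ ⟨α, rfl⟩
    exact hcW α
  have hcount : ∀ B, AnalyticSet B → B ⊆ WOset → (B ∩ range c).Countable := by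
    intro B hB hBW
    obtain ⟨o, ho, hle⟩ := exists_codedType_le_of_analyticSet hB hBW
    refine (((countable_Iic_of_lt_omega_one ho).preimage
      (f := fun α : {α : Ordinal.{0} // ω ≤ α ∧ α < ω₁} => α.1)
      Subtype.val_injective).image c).mono ?_
    rintro _ ⟨hxB, α, rfl⟩
    exact ⟨α, (hc α).symm.trans_le (hle _ hxB (hcW α)), rfl⟩
  have hunc : ¬ (range c).Countable := by
    intro h
    obtain ⟨o, ho, hle⟩ := exists_codedType_le_of_analyticSet h.measurableSet.analyticSet hZW
    let β : {α : Ordinal.{0} // ω ≤ α ∧ α < ω₁} :=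
      ⟨max ω (Order.succ o), le_max_left _ _,
        max_lt omega0_lt_omega_one ((Cardinal.isSuccLimit_omega 1).succ_lt ho)⟩
    have h1 : max ω (Order.succ o) ≤ o := (hc β).symm.trans_le (hle _ ⟨β, rfl⟩ (hcW β))
    exact ((Order.lt_succ o).trans_le (le_max_right _ _)).not_ge h1
  refine ⟨range c, hZW, ?_, fun α h0 h1 => ⟨_, ⟨⟨α, h0, h1⟩, rfl⟩, hcW _, hc _⟩, ?_, ?_, ?_⟩
  · rintro _ ⟨α, rfl⟩
    exact ⟨hcW α, (hc α).symm ▸ α.2⟩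
  · rintro _ ⟨α, rfl⟩ _ ⟨β, rfl⟩ hz hw h
    rw [Subtype.ext ((hc α).symm.trans (h.trans (hc β)))]
  · intro A hA hAu
    have hdiff : AnalyticSet (A ∩ WOsetᶜ) := by
      rw [inter_eq_iInter]
      exact AnalyticSet.iInter fun b => by cases b; exacts [analyticSet_compl_WOset, hA]
    by_cases hcd : (A ∩ WOsetᶜ).Countable
    · refine absurd ?_ hAu
      have hAW : AnalyticSet (A ∩ (A ∩ WOsetᶜ)ᶜ) := by
        rw [inter_eq_iInter]
        exact AnalyticSet.iInter fun b => by
          cases b; exacts [hcd.measurableSet.compl.analyticSet, hA]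
      rw [inter_union_distrib_left]
      refine Countable.union ?_ hcd
      refine (hcount _ hAW fun x hx => by_contra fun h => hx.2 ⟨hx.1, h⟩).mono ?_
      exact fun x hx => ⟨⟨hx.1, fun h => h.2 (hZW hx.2)⟩, hx.2⟩
    · obtain ⟨f, hf, hinj, hsub⟩ := containsCantorCopy_of_analyticSet hdiff hcd
      exact ⟨f, hf, hinj, hsub.trans (inter_subset_inter_right _ subset_union_right)⟩
  · intro h
    have hWX : WOset ∩ (range c ∪ WOsetᶜ) = range c := by
      rw [inter_union_distrib_left, inter_compl_self, union_empty, inter_eq_right]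
      exact hZW
    obtain ⟨f, hf, hinj, hsub⟩ := h WOset analyticSet_compl_WOset (by rwa [hWX])
    rw [hWX] at hsub
    have hr := hcount _ (isCompact_range hf).isClosed.analyticSet (hsub.trans hZW)
    rw [inter_eq_left.2 hsub] at hr
    have hC := hr.preimage hinj
    rw [preimage_range, countable_univ_iff, ← Cardinal.mk_le_aleph0_iff] at hC
    refine hC.not_gt ?_
    simpa using Cardinal.cantor Cardinal.aleph0
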